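/- For every natural number k and every robust maximal independent set M of the graph G_k: if α_0 ∉ M, then M equals M2 = {a_i, c_i, β_i : 0 ≤ i ≤ k}. -/

import Mathlib

/-- A set of vertices is independent in `G` if no two of its members are adjacent. -/
def IsIndep {V : Type*} (G : SimpleGraph V) (M : Set V) : Prop :=
  ∀ ⦃u⦄, u ∈ M → ∀ ⦃v⦄, v ∈ M → ¬ G.Adj u v

/-- A maximal independent set of `G`: independent and maximal w.r.t. inclusion among
independent sets of `G`. -/
def IsMIS {V : Type*} (G : SimpleGraph V) (M : Set V) : Prop :=
  IsIndep G M ∧ ∀ S : Set V, IsIndep G S → M ⊆ S → S = M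

/-- A robust MIS of `G`: an MIS of `G` that remains a maximal independent set in every
connected spanning subgraph of `G` (a spanning subgraph being a graph on the same vertex
set whose edge set is contained in that of `G`). -/
def IsRobustMIS {V : Type*} (G : SimpleGraph V) (M : Set V) : Prop :=
  IsMIS G M ∧ ∀ H : SimpleGraph V, H ≤ G → H.Connected → IsMIS H M

/-- Vertices of the graph `G_k`: six families `a_i, b_i, c_i, α_i, β_i, γ_i` for `0 ≤ i ≤ k`. -/
inductive GV (k : ℕ) : Type
  | a : Fin (k + 1) → GV k
  | b : Fin (k + 1) → GV k
  | c : Fin (k + 1) → GV k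
  | al : Fin (k + 1) → GV k  -- α
  | be : Fin (k + 1) → GV k  -- β
  | ga : Fin (k + 1) → GV k  -- γ
  deriving DecidableEq

/-- Base relation generating the edges of `G_k`: the 6-cycle
`a₀–b₀–c₀–γ₀–β₀–α₀–a₀` of `G₀`, and for each `1 ≤ i ≤ k` the edges
`{β_{i-1},α_i}, {β_{i-1},γ_i}, {α_i,β_i}, {γ_i,β_i}, {b_{i-1},a_i}, {b_{i-1},c_i},
{a_i,b_i}, {c_i,b_i}`. -/
def gkRel (k : ℕ) : GV k → GV k → Prop
  | GV.a i, GV.b j => i = j ∨ (i : ℕ) = (j : ℕ) + 1      -- a_i–b_i and b_{i-1}–a_i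
  | GV.b i, GV.c j => i = j ∨ (j : ℕ) = (i : ℕ) + 1      -- b_i–c_i and b_{i-1}–c_i
  | GV.al i, GV.be j => i = j ∨ (i : ℕ) = (j : ℕ) + 1    -- α_i–β_i and β_{i-1}–α_i
  | GV.be i, GV.ga j => i = j ∨ (j : ℕ) = (i : ℕ) + 1    -- β_i–γ_i and β_{i-1}–γ_i
  | GV.c i, GV.ga j => i = 0 ∧ j = 0                     -- c₀–γ₀
  | GV.al i, GV.a j => i = 0 ∧ j = 0                     -- α₀–a₀
  | _, _ => False

/-- The graph `G_k`. -/
def Gk (k : ℕ) : SimpleGraph (GV k) := SimpleGraph.fromRel (gkRel k)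

/-- The set `M1 = {α_i, γ_i, b_i : 0 ≤ i ≤ k}`. -/
def M1 (k : ℕ) : Set (GV k) :=
  {v | ∃ i : Fin (k + 1), v = GV.al i ∨ v = GV.ga i ∨ v = GV.b i}

/-- The set `M2 = {a_i, c_i, β_i : 0 ≤ i ≤ k}`. -/
def M2 (k : ℕ) : Set (GV k) :=
  {v | ∃ i : Fin (k + 1), v = GV.a i ∨ v = GV.c i ∨ v = GV.be i}

/-- A vertex outside a maximal independent set has a neighbour in it. -/
lemma IsMIS.exists_adj {V : Type*} {G : SimpleGraph V} {M : Set V} (hM : IsMIS G M) {v : V}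
    (hv : v ∉ M) : ∃ u ∈ M, G.Adj v u := by
  by_contra! hno
  have hS : IsIndep G (insert v M) := by
    rintro u (rfl | hu) w (rfl | hw)
    · exact G.irrefl
    · exact hno w hw
    · exact fun hadj => hno u hu hadj.symm
    · exact hM.1 hu hw
  exact hv (hM.2 _ hS (Set.subset_insert v M) ▸ Set.mem_insert v M)

/-- If `v` lies outside a robust MIS, has no neighbours besides `x` and `y`, and the edge `vx` is
not a bridge, then `y` belongs to the robust MIS. -/
lemma IsRobustMIS.mem_of_reachable {V : Type*} {G : SimpleGraph V} {M : Set V}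
    (hM : IsRobustMIS G M) (hG : G.Connected) {v x y : V} (hv : v ∉ M)
    (hnbr : ∀ u, G.Adj v u → u = x ∨ u = y)
    (hreach : (G \ SimpleGraph.fromEdgeSet {s(v, x)}).Reachable v x) : y ∈ M := by
  have hbridge : ¬ G.IsBridge s(v, x) := fun hb => (SimpleGraph.isBridge_iff.1 hb) hreach
  have hconn := hG.connected_delete_edge_of_not_isBridge hbridge
  obtain ⟨u, hu, hadj⟩ := (hM.2 _ (SimpleGraph.deleteEdges_le _) hconn).exists_adj hv
  rw [SimpleGraph.deleteEdges_adj] at hadj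
  rcases hnbr u hadj.1 with rfl | rfl
  · exact absurd rfl hadj.2
  · exact hu

/-- An edge `vx` of a 4-cycle `v, p, q, x` can be bypassed. -/
lemma reachable_sdiff_of_four_cycle {V : Type*} {G : SimpleGraph V} {v p q x : V}
    (h₁ : G.Adj v p) (h₂ : G.Adj p q) (h₃ : G.Adj q x) (hpx : p ≠ x) (hqv : q ≠ v) :
    (G \ SimpleGraph.fromEdgeSet {s(v, x)}).Reachable v x := by
  have e₁ : (G \ SimpleGraph.fromEdgeSet {s(v, x)}).Adj v p := by
    have := h₁.ne
    simp
    grind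
  have e₂ : (G \ SimpleGraph.fromEdgeSet {s(v, x)}).Adj p q := by
    have := h₁.ne
    simp
    grind
  have e₃ : (G \ SimpleGraph.fromEdgeSet {s(v, x)}).Adj q x := by
    simp
    grind
  exact e₁.reachable.trans (e₂.reachable.trans e₃.reachable)

/-- An edge `vx` of a 6-cycle `v, p, q, r, s, x` can be bypassed. -/
lemma reachable_sdiff_of_six_cycle {V : Type*} {G : SimpleGraph V} {v p q r s x : V}
    (h₁ : G.Adj v p) (h₂ : G.Adj p q) (h₃ : G.Adj q r) (h₄ : G.Adj r s) (h₅ : G.Adj s x)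
    (hpx : p ≠ x) (hqv : q ≠ v) (hqx : q ≠ x) (hrv : r ≠ v) (hsv : s ≠ v) :
    (G \ SimpleGraph.fromEdgeSet {s(v, x)}).Reachable v x := by
  have e₁ : (G \ SimpleGraph.fromEdgeSet {s(v, x)}).Adj v p := by
    have := h₁.ne
    simp
    grind
  have e₂ : (G \ SimpleGraph.fromEdgeSet {s(v, x)}).Adj p q := by
    have := h₁.ne
    simp
    grind
  have e₃ : (G \ SimpleGraph.fromEdgeSet {s(v, x)}).Adj q r := by
    simp
    grind
  have e₄ : (G \ SimpleGraph.fromEdgeSet {s(v, x)}).Adj r s := by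
    simp
    grind
  have e₅ : (G \ SimpleGraph.fromEdgeSet {s(v, x)}).Adj s x := by
    simp
    grind
  exact e₁.reachable.trans (e₂.reachable.trans (e₃.reachable.trans
    (e₄.reachable.trans e₅.reachable)))

section Edges

variable {k : ℕ}

lemma Gk_adj_a_b (i : Fin (k + 1)) : (Gk k).Adj (GV.a i) (GV.b i) := by
  simp [Gk, gkRel]

lemma Gk_adj_b_c (i : Fin (k + 1)) : (Gk k).Adj (GV.b i) (GV.c i) := by
  simp [Gk, gkRel]

lemma Gk_adj_al_be (i : Fin (k + 1)) : (Gk k).Adj (GV.al i) (GV.be i) := by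
  simp [Gk, gkRel]

lemma Gk_adj_be_ga (i : Fin (k + 1)) : (Gk k).Adj (GV.be i) (GV.ga i) := by
  simp [Gk, gkRel]

lemma Gk_adj_c_ga_zero : (Gk k).Adj (GV.c 0) (GV.ga 0) := by
  simp [Gk, gkRel]

lemma Gk_adj_al_a_zero : (Gk k).Adj (GV.al 0) (GV.a 0) := by
  simp [Gk, gkRel]

lemma Gk_adj_a_b_succ (i : Fin k) : (Gk k).Adj (GV.a i.succ) (GV.b i.castSucc) := by
  simp [Gk, gkRel]

lemma Gk_adj_b_c_succ (i : Fin k) : (Gk k).Adj (GV.b i.castSucc) (GV.c i.succ) := by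
  simp [Gk, gkRel]

lemma Gk_adj_al_be_succ (i : Fin k) : (Gk k).Adj (GV.al i.succ) (GV.be i.castSucc) := by
  simp [Gk, gkRel]

lemma Gk_adj_be_ga_succ (i : Fin k) : (Gk k).Adj (GV.be i.castSucc) (GV.ga i.succ) := by
  simp [Gk, gkRel]

end Edges

lemma Gk_connected (k : ℕ) : (Gk k).Connected := by
  have hb : ∀ i : Fin (k + 1), (Gk k).Reachable (GV.al 0) (GV.b i) := by
    intro i
    induction i using Fin.induction with
    | zero => exact Gk_adj_al_a_zero.reachable.trans (Gk_adj_a_b 0).reachable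
    | succ i ih =>
      exact ih.trans ((Gk_adj_a_b_succ i).symm.reachable.trans (Gk_adj_a_b i.succ).reachable)
  have hbe : ∀ i : Fin (k + 1), (Gk k).Reachable (GV.al 0) (GV.be i) := by
    intro i
    induction i using Fin.induction with
    | zero => exact (Gk_adj_al_be 0).reachable
    | succ i ih =>
      exact ih.trans ((Gk_adj_al_be_succ i).symm.reachable.trans (Gk_adj_al_be i.succ).reachable)
  refine (SimpleGraph.connected_iff_exists_forall_reachable _).2 ⟨GV.al 0, ?_⟩
  rintro (i | i | i | i | i | i)
  · exact (hb i).trans (Gk_adj_a_b i).symm.reachable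
  · exact hb i
  · exact (hb i).trans (Gk_adj_b_c i).reachable
  · exact (hbe i).trans (Gk_adj_al_be i).symm.reachable
  · exact hbe i
  · exact (hbe i).trans (Gk_adj_be_ga i).reachable

/-- For every robust MIS `M` of `G_k`: if `α₀ ∉ M`, then
`M = M2 = {a_i, c_i, β_i : 0 ≤ i ≤ k}`. -/
theorem stmt_15 (k : ℕ) (M : Set (GV k)) (hM : IsRobustMIS (Gk k) M)
    (h : GV.al (0 : Fin (k + 1)) ∉ M) :
    M = M2 k := by
  have hG := Gk_connected k
  have hindep := hM.1.1
  have ha0 : GV.a 0 ∈ M := by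
    refine hM.mem_of_reachable hG h (x := GV.be 0) ?_ ?_
    · rintro (j | j | j | j | j | j) <;> simp [Gk, gkRel] <;> grind
    · exact reachable_sdiff_of_six_cycle Gk_adj_al_a_zero (Gk_adj_a_b 0) (Gk_adj_b_c 0)
        Gk_adj_c_ga_zero (Gk_adj_be_ga 0).symm
        (by simp) (by simp) (by simp) (by simp) (by simp)
  have hbe0 : GV.be 0 ∈ M := by
    refine hM.mem_of_reachable hG h (x := GV.a 0) ?_ ?_
    · rintro (j | j | j | j | j | j) <;> simp [Gk, gkRel] <;> grind
    · exact reachable_sdiff_of_six_cycle (Gk_adj_al_be 0) (Gk_adj_be_ga 0) Gk_adj_c_ga_zero.symm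
        (Gk_adj_b_c 0).symm (Gk_adj_a_b 0).symm
        (by simp) (by simp) (by simp) (by simp) (by simp)
  have hga0 : GV.ga 0 ∉ M := fun hmem => hindep hbe0 hmem (Gk_adj_be_ga 0)
  have hc0 : GV.c 0 ∈ M := by
    refine hM.mem_of_reachable hG hga0 (x := GV.be 0) ?_ ?_
    · rintro (j | j | j | j | j | j) <;> simp [Gk, gkRel]
    · exact reachable_sdiff_of_six_cycle Gk_adj_c_ga_zero.symm (Gk_adj_b_c 0).symm
        (Gk_adj_a_b 0).symm Gk_adj_al_a_zero.symm (Gk_adj_al_be 0)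
        (by simp) (by simp) (by simp) (by simp) (by simp)
  have hbe : ∀ i : Fin (k + 1), GV.be i ∈ M := by
    intro i
    induction i using Fin.induction with
    | zero => exact hbe0
    | succ i ih =>
      have hal : GV.al i.succ ∉ M := fun hmem => hindep hmem ih (Gk_adj_al_be_succ i)
      refine hM.mem_of_reachable hG hal (x := GV.be i.castSucc) ?_ ?_
      · rintro (j | j | j | j | j | j) <;> simp [Gk, gkRel] <;>
            grind [Fin.ext_iff, Fin.val_castSucc]
      · exact reachable_sdiff_of_four_cycle (Gk_adj_al_be i.succ) (Gk_adj_be_ga i.succ)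
          (Gk_adj_be_ga_succ i).symm (by simp [Fin.ext_iff]) (by simp)
  have hac : ∀ i : Fin (k + 1), GV.a i ∈ M ∧ GV.c i ∈ M := by
    intro i
    induction i using Fin.induction with
    | zero => exact ⟨ha0, hc0⟩
    | succ i ih =>
      have hb : GV.b i.castSucc ∉ M := fun hmem => hindep ih.1 hmem (Gk_adj_a_b i.castSucc)
      constructor
      · by_contra ha
        refine hb (hM.mem_of_reachable hG ha (x := GV.b i.succ) ?_ ?_)
        · rintro (j | j | j | j | j | j) <;> simp [Gk, gkRel] <;>
            grind [Fin.ext_iff, Fin.val_castSucc]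
        · exact reachable_sdiff_of_four_cycle (Gk_adj_a_b_succ i) (Gk_adj_b_c_succ i)
            (Gk_adj_b_c i.succ).symm (by simp [Fin.ext_iff]) (by simp)
      · by_contra hc
        refine hb (hM.mem_of_reachable hG hc (x := GV.b i.succ) ?_ ?_)
        · rintro (j | j | j | j | j | j) <;> simp [Gk, gkRel] <;>
            grind [Fin.ext_iff, Fin.val_castSucc]
        · exact reachable_sdiff_of_four_cycle (Gk_adj_b_c_succ i).symm (Gk_adj_a_b_succ i).symm
            (Gk_adj_a_b i.succ) (by simp [Fin.ext_iff]) (by simp)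
  ext v
  rcases v with i | i | i | i | i | i
  · simpa [M2] using (hac i).1
  · simpa [M2] using fun hmem => hindep (hac i).1 hmem (Gk_adj_a_b i)
  · simpa [M2] using (hac i).2
  · simpa [M2] using fun hmem => hindep hmem (hbe i) (Gk_adj_al_be i)
  · simpa [M2] using hbe i
  · simpa [M2] using fun hmem => hindep (hbe i) hmem (Gk_adj_be_ga i)
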